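/- Let G be a finite group and let X and X' be G-modules that are free as ℤ-modules. Then X and X' are cohomologically equivalent if and only if there exist projective ℤ[G]-modules P and P' such that X ⊕ P ≅ X' ⊕ P' as G-modules. -/

import Mathlib

/-!
This file sets up Tate cohomology of a finite group `G` (with coefficients in objects of
`Rep ℤ G`), realized concretely in each degree `n ∈ ℤ` as
`Ĥ^n(G, M) = Ĥ⁰(G, Hom_ℤ(J n, M))`, where `J n` is the standard `n`-th syzygy of the
trivial module `ℤ` (the `n`-th tensor power of the augmentation ideal `I_G` for `n ≥ 0`,
and of its `ℤ`-linear dual for `n < 0`), and `Ĥ⁰` denotes invariants modulo norms.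
Cup products are induced by the canonical comparison maps `J (i+j) ⟶ J i ⊗ J j`.
-/

open CategoryTheory MonoidalCategory TensorProduct

set_option linter.unusedSectionVars false
set_option maxHeartbeats 1000000

attribute [instance 0] AddCommGroup.toIntModule
attribute [instance 0] instMulActionIntOfSubtractionMonoid

namespace Enc

variable {k : Type} [CommRing k] {G : Type} [Group G] [Fintype G]

/-! ### Degree-zero Tate cohomology: invariants modulo norms -/

section Aux
variable {V V₂ : Type} [AddCommGroup V] [Module k V] [AddCommGroup V₂] [Module k V₂]

/-- The norm map `v ↦ ∑_{g ∈ G} g • v` of a representation. -/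
noncomputable def rnorm (ρ : Representation k G V) : V →ₗ[k] V := ∑ g : G, ρ g

lemma rnorm_mem_invariants (ρ : Representation k G V) (v : V) :
    rnorm ρ v ∈ ρ.invariants := by
  intro g
  show (ρ g) ((∑ h : G, ρ h) v) = _
  simp only [LinearMap.sum_apply, map_sum]
  rw [Fintype.sum_equiv (Equiv.mulLeft g) _ (fun h => ρ h v) (fun h => by
    rw [← Module.End.mul_apply, ← map_mul]; rfl)]
  simp [rnorm]

/-- The norm map, viewed as landing in the invariants. -/
noncomputable def rnormRes (ρ : Representation k G V) : V →ₗ[k] ρ.invariants :=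
  (rnorm ρ).codRestrict ρ.invariants (rnorm_mem_invariants ρ)

/-- The image of the norm map, inside the invariants. -/
noncomputable def rnormIm (ρ : Representation k G V) : Submodule k ρ.invariants :=
  LinearMap.range (rnormRes ρ)

/-- Degree-zero Tate cohomology of a representation: invariants modulo norms. -/
noncomputable def tate0 (ρ : Representation k G V) : Type :=
  ρ.invariants ⧸ rnormIm ρ

noncomputable instance (ρ : Representation k G V) : AddCommGroup (tate0 ρ) :=
  inferInstanceAs (AddCommGroup (ρ.invariants ⧸ rnormIm ρ))

noncomputable instance (ρ : Representation k G V) : Module k (tate0 ρ) :=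
  inferInstanceAs (Module k (ρ.invariants ⧸ rnormIm ρ))

/-- The Tate class of an invariant vector. -/
noncomputable def tate0mk {ρ : Representation k G V} (v : V) (hv : v ∈ ρ.invariants) :
    tate0 ρ := Submodule.Quotient.mk (⟨v, hv⟩ : ρ.invariants)

lemma invariants_comp {ρ : Representation k G V} {σ : Representation k G V₂}
    (f : V →ₗ[k] V₂) (hf : ∀ (g : G) (v : V), f (ρ g v) = σ g (f v)) :
    ∀ x ∈ ρ.invariants, f x ∈ σ.invariants := by
  intro x hx g
  rw [← hf g x, hx g]

/-- Functoriality of degree-zero Tate cohomology along equivariant maps. -/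
noncomputable def tate0map {ρ : Representation k G V} {σ : Representation k G V₂}
    (f : V →ₗ[k] V₂) (hf : ∀ (g : G) (v : V), f (ρ g v) = σ g (f v)) :
    tate0 ρ →ₗ[k] tate0 σ :=
  Submodule.mapQ (rnormIm ρ) (rnormIm σ) (f.restrict (invariants_comp f hf))
    (by
      rintro ⟨x, hx⟩ ⟨y, hy⟩
      refine ⟨f y, ?_⟩
      apply Subtype.ext
      have hy' := congrArg Subtype.val hy
      show rnorm σ (f y) = _
      simp only [LinearMap.restrict_apply]
      have : rnorm σ (f y) = f (rnorm ρ y) := by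
        simp only [rnorm, LinearMap.sum_apply, map_sum]
        exact Finset.sum_congr rfl fun g _ => (hf g y).symm
      rw [this]
      exact congrArg f hy')

end Aux

/-- Degree-zero Tate cohomology `Ĥ⁰(G, W) = W^G / N_G W` of an object of `Rep k G`. -/
noncomputable def H0T (W : Rep k G) : Type := tate0 W.ρ

noncomputable instance (W : Rep k G) : AddCommGroup (H0T W) :=
  inferInstanceAs (AddCommGroup (tate0 W.ρ))

noncomputable instance (W : Rep k G) : Module k (H0T W) :=
  inferInstanceAs (Module k (tate0 W.ρ))

/-- Functoriality of `Ĥ⁰` along morphisms of representations. -/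
noncomputable def H0Tmap {W W' : Rep k G} (ψ : W ⟶ W') : H0T W →ₗ[k] H0T W' :=
  tate0map ψ.hom (fun g v => Rep.hom_comm_apply ψ g v)

/-! ### The augmentation ideal and the syzygy modules `J n` -/

variable (G)

/-- The representation on `H →₀ k` induced by an action of `G` on `H` (this is what
`Representation.ofMulAction` was in the older Mathlib). -/
noncomputable def ofMulAction (k : Type) [CommSemiring k] (G : Type) [Monoid G] (H : Type)
    [MulAction G H] : Representation k G (H →₀ k) where
  toFun g := Finsupp.lmapDomain k k (g • ·)
  map_one' := by ext; simp
  map_mul' x y := by ext; simp [mul_smul]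

theorem ofMulAction_def {k : Type} [CommSemiring k] {G : Type} [Monoid G] {H : Type}
    [MulAction G H] (g : G) : ofMulAction k G H g = Finsupp.lmapDomain k k (g • ·) := rfl

/-- The augmentation map `ℤ[G] → ℤ`. -/
noncomputable def aug : (G →₀ ℤ) →ₗ[ℤ] ℤ :=
  Finsupp.linearCombination ℤ (fun _ : G => (1 : ℤ))

lemma aug_comm (g : G) (x : G →₀ ℤ) :
    aug G (ofMulAction ℤ G G g x) = aug G x := by
  unfold aug
  simp [ofMulAction_def, Finsupp.linearCombination_apply]
  rw [Finsupp.sum_mapDomain_index] <;> simp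

/-- The underlying `ℤ`-module of the augmentation ideal. -/
noncomputable abbrev IGcar : Type := LinearMap.ker (aug G)

/-- The representation of `G` on the augmentation ideal. -/
noncomputable def IGρ : Representation ℤ G (IGcar G) where
  toFun g := (ofMulAction ℤ G G g).restrict (p := LinearMap.ker (aug G))
    (q := LinearMap.ker (aug G)) (by
      intro x hx
      simp only [LinearMap.mem_ker] at hx ⊢
      rw [aug_comm]; exact hx)
  map_one' := by ext x; simp [LinearMap.restrict_apply]
  map_mul' g h := by ext x; simp [LinearMap.restrict_apply, Module.End.mul_apply]

/-- The augmentation ideal `I_G` of `ℤ[G]`, as an object of `Rep ℤ G`. -/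
noncomputable def IGrep : Rep ℤ G := Rep.of (IGρ G)

/-- `Hom_ℤ(X, A)` with the conjugation `G`-action, i.e. the internal hom in `Rep ℤ G`. -/
noncomputable abbrev hRep {G : Type} [Group G] (X A : Rep.{0} ℤ G) : Rep.{0} ℤ G :=
  (Rep.ihom X).obj A

/-- The `ℤ`-linear dual of the augmentation ideal, as an object of `Rep ℤ G`. -/
noncomputable def DIG : Rep ℤ G := hRep (IGrep G) (𝟙_ (Rep ℤ G))

instance : Module.Finite ℤ (IGcar G) := by
  have : Module.Finite ℤ (G →₀ ℤ) :=
    Module.Finite.equiv (Finsupp.linearEquivFunOnFinite ℤ ℤ G).symm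
  exact Module.Finite.of_injective (LinearMap.ker (aug G)).subtype Subtype.val_injective

instance : Module.Free ℤ (IGcar G) := by infer_instance

/-- Nonnegative tensor powers `I_G^{⊗ n}` (with `I_G^{⊗ 0} = ℤ`). -/
noncomputable def Jp : ℕ → Rep ℤ G
  | 0 => 𝟙_ (Rep ℤ G)
  | n + 1 => Jp n ⊗ IGrep G

/-- Tensor powers of the dual of the augmentation ideal. -/
noncomputable def Jn : ℕ → Rep ℤ G
  | 0 => 𝟙_ (Rep ℤ G)
  | n + 1 => Jn n ⊗ DIG G

/-- The standard syzygy modules of the trivial representation `ℤ`, indexed by `ℤ`: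
`J n = I_G^{⊗ n}` for `n ≥ 0`, and `J n = (I_G^∨)^{⊗ (-n)}` for `n < 0`. -/
noncomputable def J : ℤ → Rep ℤ G
  | .ofNat n => Jp G n
  | .negSucc n => Jn G (n + 1)

lemma J_ofNat (m : ℕ) : J G (m : ℤ) = Jp G m := rfl

lemma J_neg (m : ℕ) : J G (-(m : ℤ)) = Jn G m := by cases m <;> rfl

/-- The element of `(I_G)^∨ ⊗ I_G` corresponding to the identity map. -/
noncomputable def preElt : Module.Dual ℤ (IGcar G) ⊗[ℤ] IGcar G :=
  (dualTensorHomEquiv ℤ (IGcar G) (IGcar G)).symm LinearMap.id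

/-- The canonical element of `I_G ⊗ (I_G)^∨` corresponding to the identity map. -/
noncomputable def coevElt : (IGrep G ⊗ DIG G).V :=
  (TensorProduct.comm ℤ _ _) (preElt G)

lemma conj_dualTensor (g : G) (t : Module.Dual ℤ (IGcar G) ⊗[ℤ] IGcar G) :
    dualTensorHom ℤ _ _ (TensorProduct.map ((DIG G).ρ g) ((IGrep G).ρ g) t)
      = (IGrep G).ρ g ∘ₗ (dualTensorHom ℤ _ _ t) ∘ₗ (IGrep G).ρ g⁻¹ := by
  have key : ∀ (a b : IGcar G →ₗ[ℤ] IGcar G)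
      (a' : Module.Dual ℤ (IGcar G) →ₗ[ℤ] Module.Dual ℤ (IGcar G))
      (_ : ∀ f w, a' f w = f (b w)) (t : Module.Dual ℤ (IGcar G) ⊗[ℤ] IGcar G),
      dualTensorHom ℤ _ _ (TensorProduct.map a' a t) = a ∘ₗ (dualTensorHom ℤ _ _ t) ∘ₗ b := by
    intro a b a' hab t
    induction t with
    | zero => simp
    | tmul f v =>
        apply LinearMap.ext
        intro w
        simp only [TensorProduct.map_tmul, dualTensorHom_apply,
          LinearMap.comp_apply, map_smul, hab]
    | add x y hx hy =>
        simp only [map_add, hx, hy, LinearMap.add_comp, LinearMap.comp_add]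
  exact key ((IGrep G).ρ g) ((IGrep G).ρ g⁻¹) ((DIG G).ρ g) (fun _ _ => rfl) t

lemma coevElt_invariant (g : G) :
    ((IGrep G ⊗ DIG G).ρ g) (coevElt G) = coevElt G := by
  show TensorProduct.map ((IGrep G).ρ g) ((DIG G).ρ g)
      ((TensorProduct.comm ℤ _ _) (preElt G)) = _
  refine (TensorProduct.map_comm _ _ _).trans ?_
  show (TensorProduct.comm ℤ _ _) (TensorProduct.map ((DIG G).ρ g) ((IGrep G).ρ g) (preElt G))
      = (TensorProduct.comm ℤ _ _) (preElt G)
  congr 1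
  apply (dualTensorHomEquiv ℤ (IGcar G) (IGcar G)).injective
  have h2 : dualTensorHom ℤ (IGcar G) (IGcar G) (preElt G) = LinearMap.id :=
    (dualTensorHomEquiv ℤ (IGcar G) (IGcar G)).apply_symm_apply LinearMap.id
  show dualTensorHom ℤ (IGcar G) (IGcar G)
      (TensorProduct.map ((DIG G).ρ g) ((IGrep G).ρ g) (preElt G))
    = dualTensorHom ℤ (IGcar G) (IGcar G) (preElt G)
  refine (conj_dualTensor G g (preElt G)).trans ?_
  show (IGrep G).ρ g ∘ₗ dualTensorHom ℤ (IGcar G) (IGcar G) (preElt G) ∘ₗ (IGrep G).ρ g⁻¹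
      = dualTensorHom ℤ (IGcar G) (IGcar G) (preElt G)
  rw [h2]
  apply LinearMap.ext
  intro v
  exact Representation.self_inv_apply (IGrep G).ρ g v

/-- The coevaluation `ℤ ⟶ I_G ⊗ I_G^∨`. -/
noncomputable def coev : 𝟙_ (Rep ℤ G) ⟶ IGrep G ⊗ DIG G := Rep.ofHom
  { toLinearMap := LinearMap.toSpanSingleton ℤ _ (coevElt G)
    isIntertwining' := by
      intro g
      apply LinearMap.ext
      intro z
      show LinearMap.toSpanSingleton ℤ _ (coevElt G) ((𝟙_ (Rep ℤ G)).ρ g z)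
          = ((IGrep G ⊗ DIG G).ρ g) (LinearMap.toSpanSingleton ℤ _ (coevElt G) z)
      have hz : ((𝟙_ (Rep ℤ G)).ρ g z) = z := rfl
      rw [hz]
      show z • coevElt G = ((IGrep G ⊗ DIG G).ρ g) (z • coevElt G)
      rw [map_smul, coevElt_invariant] }


variable {G}

/-- One-step comparison `J (n+1) ⟶ J n ⊗ I_G`. -/
noncomputable def sMap : ∀ n : ℤ, J G (n + 1) ⟶ J G n ⊗ IGrep G
  | .ofNat m => 𝟙 (Jp G m ⊗ IGrep G)
  | .negSucc 0 =>
      coev G ≫ (β_ (IGrep G) (DIG G)).hom ≫ ((λ_ (DIG G)).inv ▷ IGrep G)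
  | .negSucc (m+1) =>
      (ρ_ (Jn G (m+1))).inv ≫ (Jn G (m+1) ◁ (coev G ≫ (β_ (IGrep G) (DIG G)).hom))
        ≫ (α_ (Jn G (m+1)) (DIG G) (IGrep G)).inv

/-- One-step comparison `J (n-1) ⟶ J n ⊗ I_G^∨`. -/
noncomputable def tMap : ∀ n : ℤ, J G (n - 1) ⟶ J G n ⊗ DIG G
  | .ofNat 0 => 𝟙 (𝟙_ (Rep ℤ G) ⊗ DIG G)
  | .ofNat (m+1) =>
      eqToHom (congrArg (J G) (show (Int.ofNat (m+1)) - 1 = ((m:ℕ) : ℤ) by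
        rw [Int.ofNat_eq_coe]; push_cast; ring)) ≫
      (ρ_ (Jp G m)).inv ≫ (Jp G m ◁ coev G) ≫ (α_ (Jp G m) (IGrep G) (DIG G)).inv
  | .negSucc m => eqToHom (show J G (Int.negSucc m - 1) = J G (Int.negSucc m) ⊗ DIG G from rfl)

/-- Comparison maps `J (i + m) ⟶ J i ⊗ J m` for `m ≥ 0`. -/
noncomputable def μpos (i : ℤ) : ∀ m : ℕ, J G (i + m) ⟶ J G i ⊗ J G (m : ℤ)
  | 0 => eqToHom (congrArg (J G) (by omega)) ≫ (ρ_ (J G i)).inv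
  | m + 1 =>
      eqToHom (congrArg (J G) (show i + ((m:ℕ)+1:ℕ) = (i + m) + 1 by omega))
        ≫ sMap (i + m) ≫ (μpos i m ▷ IGrep G) ≫ (α_ (J G i) (J G (m:ℤ)) (IGrep G)).hom

/-- Comparison maps `J (i - m) ⟶ J i ⊗ J (-m)` for `m ≥ 0`. -/
noncomputable def μneg (i : ℤ) : ∀ m : ℕ, J G (i - m) ⟶ J G i ⊗ J G (-(m : ℤ))
  | 0 => eqToHom (congrArg (J G) (by omega)) ≫ (ρ_ (J G i)).inv
  | m + 1 =>
      eqToHom (congrArg (J G) (show i - ((m:ℕ)+1:ℕ) = (i - m) - 1 by omega))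
        ≫ tMap (i - m) ≫ (μneg i m ▷ DIG G) ≫ (α_ (J G i) (J G (-(m:ℤ))) (DIG G)).hom
        ≫ (J G i ◁ (eqToHom (show J G (-(m:ℤ)) ⊗ DIG G = J G (-((m:ℕ)+1:ℕ)) by
            rw [J_neg, J_neg]; rfl)))

variable (G)

/-- The canonical comparison map `J (i+j) ⟶ J i ⊗ J j`, implementing the standard stable
equivalences between the syzygies `J`; it induces the cup product on Tate cohomology. -/
noncomputable def μ (i : ℤ) : ∀ j : ℤ, J G (i + j) ⟶ J G i ⊗ J G j
  | .ofNat m => μpos i m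
  | .negSucc m =>
      eqToHom (congrArg (J G) (show i + Int.negSucc m = i - ((m+1 : ℕ) : ℤ) by
        rw [Int.negSucc_eq]; push_cast; ring))
        ≫ μneg i (m+1)

variable {G}

/-! ### Tate cohomology in all degrees, functoriality, cup products -/

/-- Tate cohomology `Ĥ^n(G, M)` of the finite group `G` with coefficients in `M : Rep ℤ G`,
realized as `Ĥ⁰(G, Hom_ℤ(J n, M))` for the standard `n`-th syzygy `J n` of `ℤ`. -/
noncomputable def tate (n : ℤ) (M : Rep ℤ G) : Type := H0T (hRep (J G n) M)

noncomputable instance (n : ℤ) (M : Rep ℤ G) : AddCommGroup (tate n M) :=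
  inferInstanceAs (AddCommGroup (H0T (hRep (J G n) M)))

/-- The map on Tate cohomology induced by a morphism of representations. -/
noncomputable def tmap (n : ℤ) {M N : Rep ℤ G} (φ : M ⟶ N) : tate n M → tate n N :=
  H0Tmap ((Rep.ihom (J G n)).map φ)

/-- Transport of Tate cohomology along an equality of degrees. -/
noncomputable def tcast {i j : ℤ} {M : Rep ℤ G} (h : i = j) (z : tate i M) : tate j M :=
  h ▸ z

lemma hom_invariant {X W : Rep.{0} ℤ G} (m : X ⟶ W) :
    m.hom.toLinearMap ∈ (Representation.linHom X.ρ W.ρ).invariants := by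
  intro g
  show W.ρ g ∘ₗ m.hom.toLinearMap ∘ₗ X.ρ g⁻¹ = m.hom.toLinearMap
  ext v
  simp only [LinearMap.comp_apply]
  erw [Rep.hom_comm_apply m g⁻¹ v, Representation.self_inv_apply]; rfl

/-- The Tate cohomology class of a `G`-equivariant map `J n ⟶ W`. -/
noncomputable def mkCls {n : ℤ} {W : Rep ℤ G} (m : J G n ⟶ W) : tate n W :=
  tate0mk m.hom.toLinearMap (hom_invariant m)


lemma tensor_rho_eq (M N : Rep ℤ G) (g : G) :
    (M ⊗ N).ρ g = TensorProduct.map (M.ρ g) (N.ρ g) := rfl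

lemma cup_invariance {i j : ℤ} {M N : Rep ℤ G}
    (f : ((hRep (J G i) M).ρ.invariants))
    (g : ((hRep (J G j) N).ρ.invariants)) :
    (TensorProduct.map f.1 g.1).comp ((μ G i j).hom.toLinearMap)
      ∈ (hRep (J G (i + j)) (M ⊗ N)).ρ.invariants := by
  intro gg
  have hf : M.ρ gg ∘ₗ f.1 ∘ₗ (J G i).ρ gg⁻¹ = f.1 := f.2 gg
  have hg : N.ρ gg ∘ₗ g.1 ∘ₗ (J G j).ρ gg⁻¹ = g.1 := g.2 gg
  have hμ : (μ G i j).hom.toLinearMap.comp ((J G (i + j)).ρ gg⁻¹)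
      = (TensorProduct.map ((J G i).ρ gg⁻¹) ((J G j).ρ gg⁻¹)).comp (μ G i j).hom.toLinearMap := by
    have h := (μ G i j).hom.isIntertwining' gg⁻¹
    exact h
  have key : ∀ (a : (J G i).V →ₗ[ℤ] M.V) (b : (J G j).V →ₗ[ℤ] N.V)
      (_ : M.ρ gg ∘ₗ a ∘ₗ (J G i).ρ gg⁻¹ = a) (_ : N.ρ gg ∘ₗ b ∘ₗ (J G j).ρ gg⁻¹ = b),
      TensorProduct.map (M.ρ gg) (N.ρ gg) ∘ₗ
          ((TensorProduct.map a b).comp (μ G i j).hom.toLinearMap) ∘ₗ (J G (i + j)).ρ gg⁻¹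
        = (TensorProduct.map a b).comp (μ G i j).hom.toLinearMap := by
    intro a b ha hb
    have hab := TensorProduct.map_comp (M.ρ gg) (N.ρ gg) (a ∘ₗ (J G i).ρ gg⁻¹)
      (b ∘ₗ (J G j).ρ gg⁻¹)
    rw [ha, hb, TensorProduct.map_comp] at hab
    refine (congrArg (fun x => TensorProduct.map (M.ρ gg) (N.ρ gg) ∘ₗ
      TensorProduct.map a b ∘ₗ x) hμ).trans ?_
    exact (congrArg (fun x => x ∘ₗ (μ G i j).hom.toLinearMap) hab).symm
  exact key f.1 g.1 hf hg

lemma conj_term {i j : ℤ} {M N : Rep ℤ G} (u : (J G i).V →ₗ[ℤ] M.V)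
    (w : (J G j).V →ₗ[ℤ] N.V) (h : G) :
    (TensorProduct.map (M.ρ h ∘ₗ u ∘ₗ (J G i).ρ h⁻¹) (N.ρ h ∘ₗ w ∘ₗ (J G j).ρ h⁻¹)).comp
        (μ G i j).hom.toLinearMap
      = ((hRep (J G (i + j)) (M ⊗ N)).ρ h) ((TensorProduct.map u w).comp (μ G i j).hom.toLinearMap) := by
  have hμ : (μ G i j).hom.toLinearMap ∘ₗ (J G (i + j)).ρ h⁻¹
      = TensorProduct.map ((J G i).ρ h⁻¹) ((J G j).ρ h⁻¹) ∘ₗ (μ G i j).hom.toLinearMap := by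
    have hc := (μ G i j).hom.isIntertwining' h⁻¹
    exact hc
  show _ = (M ⊗ N).ρ h ∘ₗ ((TensorProduct.map u w).comp (μ G i j).hom.toLinearMap) ∘ₗ (J G (i + j)).ρ h⁻¹
  rw [LinearMap.comp_assoc, hμ, ← LinearMap.comp_assoc, ← LinearMap.comp_assoc]
  rw [TensorProduct.map_comp, TensorProduct.map_comp]
  rfl

lemma cup_norm_left {i j : ℤ} {M N : Rep ℤ G} (u : (J G i).V →ₗ[ℤ] M.V)
    (g : ((hRep (J G j) N).ρ.invariants)) :
    (TensorProduct.map (rnorm ((hRep (J G i) M).ρ) u) g.1).comp (μ G i j).hom.toLinearMap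
      = rnorm ((hRep (J G (i + j)) (M ⊗ N)).ρ)
          ((TensorProduct.map u g.1).comp (μ G i j).hom.toLinearMap) := by
  have h1 : rnorm ((hRep (J G i) M).ρ) u = ∑ h : G, ((hRep (J G i) M).ρ h) u := by
    exact LinearMap.sum_apply _ _ _
  have h2 : rnorm ((hRep (J G (i + j)) (M ⊗ N)).ρ) ((TensorProduct.map u g.1).comp (μ G i j).hom.toLinearMap)
      = ∑ h : G, ((hRep (J G (i + j)) (M ⊗ N)).ρ h)
          ((TensorProduct.map u g.1).comp (μ G i j).hom.toLinearMap) := by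
    exact LinearMap.sum_apply _ _ _
  have key : ∀ (F : G → (J G i).V →ₗ[ℤ] M.V) (b : (J G j).V →ₗ[ℤ] N.V),
      (TensorProduct.map (∑ h : G, F h) b).comp (μ G i j).hom.toLinearMap
        = ∑ h : G, (TensorProduct.map (F h) b).comp (μ G i j).hom.toLinearMap := by
    intro F b
    rw [show TensorProduct.map (∑ h : G, F h) b = ∑ h : G, TensorProduct.map (F h) b from
      map_sum ((TensorProduct.mapBilinear (RingHom.id ℤ) _ _ _ _).flip b) _ _]
    exact map_sum ((LinearMap.llcomp ℤ _ _ _).flip (μ G i j).hom.toLinearMap) _ _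
  refine (congrArg (fun x => (TensorProduct.map x g.1).comp (μ G i j).hom.toLinearMap) h1).trans ?_
  refine (key _ _).trans (Eq.trans ?_ h2.symm)
  refine Finset.sum_congr rfl fun h _ => ?_
  have hginv : N.ρ h ∘ₗ g.1 ∘ₗ (J G j).ρ h⁻¹ = g.1 := g.2 h
  refine Eq.trans ?_ (conj_term u g.1 h)
  exact congrArg (fun x => (TensorProduct.map (M.ρ h ∘ₗ u ∘ₗ (J G i).ρ h⁻¹) x).comp
    (μ G i j).hom.toLinearMap) hginv.symm

lemma cup_norm_right {i j : ℤ} {M N : Rep ℤ G}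
    (f : ((hRep (J G i) M).ρ.invariants)) (w : (J G j).V →ₗ[ℤ] N.V) :
    (TensorProduct.map f.1 (rnorm ((hRep (J G j) N).ρ) w)).comp (μ G i j).hom.toLinearMap
      = rnorm ((hRep (J G (i + j)) (M ⊗ N)).ρ)
          ((TensorProduct.map f.1 w).comp (μ G i j).hom.toLinearMap) := by
  have h1 : rnorm ((hRep (J G j) N).ρ) w = ∑ h : G, ((hRep (J G j) N).ρ h) w := by
    exact LinearMap.sum_apply _ _ _
  have h2 : rnorm ((hRep (J G (i + j)) (M ⊗ N)).ρ) ((TensorProduct.map f.1 w).comp (μ G i j).hom.toLinearMap)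
      = ∑ h : G, ((hRep (J G (i + j)) (M ⊗ N)).ρ h)
          ((TensorProduct.map f.1 w).comp (μ G i j).hom.toLinearMap) := by
    exact LinearMap.sum_apply _ _ _
  have key : ∀ (b : (J G i).V →ₗ[ℤ] M.V) (F : G → (J G j).V →ₗ[ℤ] N.V),
      (TensorProduct.map b (∑ h : G, F h)).comp (μ G i j).hom.toLinearMap
        = ∑ h : G, (TensorProduct.map b (F h)).comp (μ G i j).hom.toLinearMap := by
    intro b F
    rw [show TensorProduct.map b (∑ h : G, F h) = ∑ h : G, TensorProduct.map b (F h) from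
      map_sum (TensorProduct.mapBilinear (RingHom.id ℤ) _ _ _ _ b) _ _]
    exact map_sum ((LinearMap.llcomp ℤ _ _ _).flip (μ G i j).hom.toLinearMap) _ _
  refine (congrArg (fun x => (TensorProduct.map f.1 x).comp (μ G i j).hom.toLinearMap) h1).trans ?_
  refine (key _ _).trans (Eq.trans ?_ h2.symm)
  refine Finset.sum_congr rfl fun h _ => ?_
  have hfinv : M.ρ h ∘ₗ f.1 ∘ₗ (J G i).ρ h⁻¹ = f.1 := f.2 h
  refine Eq.trans ?_ (conj_term f.1 w h)
  exact congrArg (fun x => (TensorProduct.map x (N.ρ h ∘ₗ w ∘ₗ (J G j).ρ h⁻¹)).comp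
    (μ G i j).hom.toLinearMap) hfinv.symm

lemma cup_welldef {i j : ℤ} {M N : Rep ℤ G}
    (a₁ : ((hRep (J G i) M).ρ.invariants)) (b₁ : ((hRep (J G j) N).ρ.invariants))
    (a₂ : ((hRep (J G i) M).ρ.invariants)) (b₂ : ((hRep (J G j) N).ρ.invariants))
    (ha : a₁ - a₂ ∈ rnormIm ((hRep (J G i) M).ρ))
    (hb : b₁ - b₂ ∈ rnormIm ((hRep (J G j) N).ρ)) :
    tate0mk (ρ := (hRep (J G (i + j)) (M ⊗ N)).ρ)
        ((TensorProduct.map a₁.1 b₁.1).comp ((μ G i j).hom.toLinearMap)) (cup_invariance a₁ b₁)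
      = tate0mk (ρ := (hRep (J G (i + j)) (M ⊗ N)).ρ)
        ((TensorProduct.map a₂.1 b₂.1).comp ((μ G i j).hom.toLinearMap)) (cup_invariance a₂ b₂) := by
  obtain ⟨u, hu⟩ := ha
  obtain ⟨w, hw⟩ := hb
  have hu' : rnorm ((hRep (J G i) M).ρ) u = a₁.1 - a₂.1 := congrArg Subtype.val hu
  have hw' : rnorm ((hRep (J G j) N).ρ) w = b₁.1 - b₂.1 := congrArg Subtype.val hw
  have step1 : tate0mk (ρ := (hRep (J G (i + j)) (M ⊗ N)).ρ)
        ((TensorProduct.map a₁.1 b₁.1).comp ((μ G i j).hom.toLinearMap))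
        (cup_invariance a₁ b₁)
      = tate0mk (ρ := (hRep (J G (i + j)) (M ⊗ N)).ρ)
        ((TensorProduct.map a₂.1 b₁.1).comp ((μ G i j).hom.toLinearMap)) (cup_invariance a₂ b₁) := by
    refine (Submodule.Quotient.eq _).mpr ?_
    refine ⟨(TensorProduct.map u b₁.1).comp ((μ G i j).hom.toLinearMap), ?_⟩
    apply Subtype.ext
    refine (cup_norm_left u b₁).symm.trans ?_
    have hsub : ∀ (a a' : (J G i).V →ₗ[ℤ] M.V) (b : (J G j).V →ₗ[ℤ] N.V),
        (TensorProduct.map (a - a') b).comp ((μ G i j).hom.toLinearMap)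
          = (TensorProduct.map a b).comp ((μ G i j).hom.toLinearMap)
            - (TensorProduct.map a' b).comp ((μ G i j).hom.toLinearMap) := by
      intro a a' b
      rw [show TensorProduct.map (a - a') b = TensorProduct.map a b - TensorProduct.map a' b from
        map_sub ((TensorProduct.mapBilinear (RingHom.id ℤ) _ _ _ _).flip b) _ _]
      exact LinearMap.sub_comp _ _ _
    exact (congrArg (fun x : (J G i).V →ₗ[ℤ] M.V => (TensorProduct.map x (b₁.1 : (J G j).V →ₗ[ℤ] N.V)).comp
      ((μ G i j).hom.toLinearMap)) hu').trans (hsub a₁.1 a₂.1 b₁.1)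
  have step2 : tate0mk (ρ := (hRep (J G (i + j)) (M ⊗ N)).ρ)
        ((TensorProduct.map a₂.1 b₁.1).comp ((μ G i j).hom.toLinearMap))
        (cup_invariance a₂ b₁)
      = tate0mk (ρ := (hRep (J G (i + j)) (M ⊗ N)).ρ)
        ((TensorProduct.map a₂.1 b₂.1).comp ((μ G i j).hom.toLinearMap)) (cup_invariance a₂ b₂) := by
    refine (Submodule.Quotient.eq _).mpr ?_
    refine ⟨(TensorProduct.map a₂.1 w).comp ((μ G i j).hom.toLinearMap), ?_⟩
    apply Subtype.ext
    refine (cup_norm_right a₂ w).symm.trans ?_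
    have hsub : ∀ (a : (J G i).V →ₗ[ℤ] M.V) (b b' : (J G j).V →ₗ[ℤ] N.V),
        (TensorProduct.map a (b - b')).comp ((μ G i j).hom.toLinearMap)
          = (TensorProduct.map a b).comp ((μ G i j).hom.toLinearMap)
            - (TensorProduct.map a b').comp ((μ G i j).hom.toLinearMap) := by
      intro a b b'
      rw [show TensorProduct.map a (b - b') = TensorProduct.map a b - TensorProduct.map a b' from
        map_sub ((TensorProduct.mapBilinear (RingHom.id ℤ) _ _ _ _) a) _ _]
      exact LinearMap.sub_comp _ _ _
    exact (congrArg (fun x : (J G j).V →ₗ[ℤ] N.V => (TensorProduct.map a₂.1 x).comp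
      ((μ G i j).hom.toLinearMap)) hw').trans (hsub a₂.1 b₁.1 b₂.1)
  exact step1.trans step2

/-- The cup product `Ĥ^i(G, M) × Ĥ^j(G, N) → Ĥ^{i+j}(G, M ⊗ N)` on Tate cohomology,
induced by the comparison maps `μ`. -/
noncomputable def cup {i j : ℤ} {M N : Rep ℤ G} (z₁ : tate i M) (z₂ : tate j N) :
    tate (i + j) (M ⊗ N) :=
  Quotient.liftOn₂ z₁ z₂
    (fun f g => tate0mk ((TensorProduct.map f.1 g.1).comp ((μ G i j).hom.toLinearMap)) (cup_invariance f g))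
    (fun a₁ b₁ a₂ b₂ ha hb => cup_welldef a₁ b₁ a₂ b₂
      ((Submodule.quotientRel_def _).mp ha) ((Submodule.quotientRel_def _).mp hb))

/-! ### Pairings -/

/-- The composition pairing `Hom_ℤ(B, C) ⊗ Hom_ℤ(A, B) ⟶ Hom_ℤ(A, C)`, `f ⊗ φ ↦ f ∘ φ`. -/
noncomputable def compPair (A B C : Rep ℤ G) : hRep B C ⊗ hRep A B ⟶ hRep A C :=
  MonoidalClosed.curry <|
    (A ◁ (β_ (hRep B C) (hRep A B)).hom) ≫ (α_ A (hRep A B) (hRep B C)).inv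
      ≫ (((ihom.ev A).app B) ▷ hRep B C) ≫ (ihom.ev B).app C

/-- The evaluation pairing `Hom_ℤ(X, B) ⊗ X ⟶ B`, `f ⊗ x ↦ f x`. -/
noncomputable def evPair (X B : Rep ℤ G) : hRep X B ⊗ X ⟶ B :=
  (β_ (hRep X B) X).hom ≫ (ihom.ev X).app B

/-- The cup product `Ĥ^i(G, Hom(X, A)) × Ĥ^j(G, Hom(X', X)) → Ĥ^{i+j}(G, Hom(X', A))`
induced by the composition pairing. -/
noncomputable def ccup {i j : ℤ} {X X' A : Rep ℤ G}
    (z : tate i (hRep X A)) (x : tate j (hRep X' X)) : tate (i + j) (hRep X' A) :=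
  tmap (i + j) (compPair X' X A) (cup z x)

/-- `ccup`, with the degree of the target adjusted along an equality of integers. -/
noncomputable def ccupTo {i j m : ℤ} {X X' A : Rep ℤ G}
    (z : tate i (hRep X A)) (x : tate j (hRep X' X)) (h : i + j = m) :
    tate m (hRep X' A) :=
  tcast h (ccup z x)

/-- The class of the identity in `Ĥ⁰(G, Hom_ℤ(X, X))`. -/
noncomputable def idCls (X : Rep ℤ G) : tate 0 (hRep X X) :=
  mkCls (MonoidalClosed.curry (ρ_ X).hom)

/-! ### Encoding pairs and related notions -/

/-- `(X, X')` is an *`r`-encoding pair* if for some `i ∈ ℤ` there is a natural isomorphism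
of functors `Ĥ^i(G, Hom_ℤ(X, -)) ≅ Ĥ^{i+r}(G, Hom_ℤ(X', -))` on `Rep ℤ G`. -/
def IsEncodingPair {G : Type} [Group G] [Fintype G] (r : ℤ) (X X' : Rep ℤ G) : Prop :=
  ∃ (i : ℤ) (e : ∀ A : Rep ℤ G, tate i (hRep X A) ≃+ tate (i + r) (hRep X' A)),
    ∀ {A B : Rep ℤ G} (φ : A ⟶ B) (z : tate i (hRep X A)),
      e B (tmap i ((Rep.ihom X).map φ) z) = tmap (i + r) ((Rep.ihom X').map φ) (e A z)

/-- `x ∈ Ĥ^r(G, Hom_ℤ(X', X))` is an *encoding element* for the pair `(X, X')` if it has a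
*decoding element* `x' ∈ Ĥ^{-r}(G, Hom_ℤ(X, X'))` with `x' ∪ x = [id_{X'}]` and
`x ∪ x' = [id_X]`. -/
def IsEncodingElement {G : Type} [Group G] [Fintype G] {r : ℤ} (X X' : Rep ℤ G)
    (x : tate r (hRep X' X)) : Prop :=
  ∃ x' : tate (-r) (hRep X X'),
    ccupTo x' x (by ring) = idCls X' ∧ ccupTo x x' (by ring) = idCls X

/-- The induced `G`-module `ℤ[G] ⊗_ℤ A ≅ (G →₀ A)`, with `G` acting by left translation. -/
noncomputable def indRep (G : Type) [Group G] (A : Type) [AddCommGroup A] [Module ℤ A] :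
    Rep ℤ G :=
  Rep.of (G := G) (X := G →₀ A)
    { toFun := fun g => Finsupp.lmapDomain A ℤ (fun h => g * h)
      map_one' := by
        ext x h
        simp [Finsupp.lmapDomain_apply, Finsupp.mapDomain_id, one_mul]
      map_mul' := fun g g' => by
        ext x h
        simp [Finsupp.lmapDomain_apply, Module.End.mul_apply, Finsupp.mapDomain_single,
          mul_assoc] }

/-- A `G`-module is *induced* if it is isomorphic to `ℤ[G] ⊗_ℤ A` for some abelian group `A`. -/
def IsInduced {G : Type} [Group G] (M : Rep ℤ G) : Prop :=
  ∃ (A : Type) (_ : AddCommGroup A) (_ : Module ℤ A), Nonempty (M ≅ indRep G A)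

/-- A class `φ ∈ Ĥ⁰(G, Hom_ℤ(X, X))` is a unit for the (composition) cup product. -/
def IsUnitCls {G : Type} [Group G] [Fintype G] {X : Rep ℤ G}
    (φ : tate 0 (hRep X X)) : Prop :=
  ∃ ψ : tate 0 (hRep X X),
    ccupTo φ ψ (by ring) = idCls X ∧ ccupTo ψ φ (by ring) = idCls X


/-- The natural map `Hom_ℤ(X, A) ⊗ I_G ⟶ Hom_ℤ(X, A ⊗ I_G)`, `f ⊗ z ↦ (x ↦ f x ⊗ z)`. -/
noncomputable def pr0 (X A : Rep ℤ G) : hRep X A ⊗ IGrep G ⟶ hRep X (A ⊗ IGrep G) :=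
  MonoidalClosed.curry ((α_ X (hRep X A) (IGrep G)).inv ≫ ((ihom.ev X).app A ▷ IGrep G))

/-- The natural evaluation map `Hom_ℤ(X, Hom_ℤ(I_G, A)) ⊗ I_G ⟶ Hom_ℤ(X, A)`,
`f ⊗ z ↦ (x ↦ f x z)`. -/
noncomputable def pr1 (X A : Rep ℤ G) :
    hRep X (hRep (IGrep G) A) ⊗ IGrep G ⟶ hRep X A :=
  MonoidalClosed.curry ((α_ X (hRep X (hRep (IGrep G) A)) (IGrep G)).inv
    ≫ ((ihom.ev X).app (hRep (IGrep G) A) ▷ IGrep G) ≫ evPair (IGrep G) A)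

/-- The natural evaluation map `Hom_ℤ(X', X) ⊗ (X' ⊗ A) ⟶ X ⊗ A`. -/
noncomputable def tPair (X' X A : Rep ℤ G) : hRep X' X ⊗ (X' ⊗ A) ⟶ X ⊗ A :=
  (α_ (hRep X' X) X' A).inv ≫ (evPair X' X ▷ A)

/-- A functor `Rep ℤ G ⥤ Rep ℤ G` sends `ℤ`-split short exact sequences of `G`-modules to
short exact sequences of `G`-modules. -/
def PreservesZSplitSES {G : Type} [Group G] (F : Rep.{0} ℤ G ⥤ Rep.{0} ℤ G) : Prop :=
  ∀ (A B C : Rep ℤ G) (f : A ⟶ B) (g : B ⟶ C),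
    Function.Injective f.hom → Function.Surjective g.hom → Function.Exact f.hom g.hom →
    (∃ s : C.V →+ B.V, ∀ x, g.hom (s x) = x) →
    Function.Injective (F.map f).hom ∧ Function.Surjective (F.map g).hom ∧
      Function.Exact (F.map f).hom (F.map g).hom

/-- A *shiftable functor*: it sends `ℤ`-split short exact sequences of `G`-modules to short
exact sequences, and sends induced modules to induced modules. -/
def Shiftable {G : Type} [Group G] (F : Rep ℤ G ⥤ Rep ℤ G) : Prop :=
  PreservesZSplitSES F ∧ ∀ M : Rep ℤ G, IsInduced M → IsInduced (F.obj M)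

end Enc

open CategoryTheory MonoidalCategory TensorProduct
set_option maxHeartbeats 1000000
open CategoryTheory MonoidalCategory Enc

namespace Enc14

variable {G : Type} [Group G] [Fintype G]

/-- A morphism is a norm. -/
def IsNorm {X Y : Rep.{0} ℤ G} (f : X ⟶ Y) : Prop :=
  ∃ h : X.V →ₗ[ℤ] Y.V, ∀ x : X.V, f.hom x = ∑ g : G, Y.ρ g (h (X.ρ g⁻¹ x))

lemma IsNorm.add {X Y : Rep.{0} ℤ G} {f f' : X ⟶ Y} (hf : IsNorm f) (hf' : IsNorm f') :
    IsNorm (f + f') := by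
  obtain ⟨h, hh⟩ := hf
  obtain ⟨h', hh'⟩ := hf'
  refine ⟨h + h', fun x => ?_⟩
  have : (f + f').hom x = f.hom x + f'.hom x := rfl
  rw [this, hh, hh', ← Finset.sum_add_distrib]
  simp

lemma IsNorm.neg {X Y : Rep.{0} ℤ G} {f : X ⟶ Y} (hf : IsNorm f) :
    IsNorm (-f) := by
  obtain ⟨h, hh⟩ := hf
  refine ⟨-h, fun x => ?_⟩
  have : (-f).hom x = -f.hom x := rfl
  rw [this, hh]
  simp

lemma IsNorm.sub {X Y : Rep.{0} ℤ G} {f f' : X ⟶ Y} (hf : IsNorm f) (hf' : IsNorm f') :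
    IsNorm (f - f') := by
  rw [sub_eq_add_neg]; exact hf.add hf'.neg

lemma IsNorm.zero {X Y : Rep.{0} ℤ G} : IsNorm (0 : X ⟶ Y) :=
  ⟨0, fun x => by simp⟩

lemma IsNorm.comp {X Y Z : Rep.{0} ℤ G} {f : X ⟶ Y} (hf : IsNorm f) (k : Y ⟶ Z) :
    IsNorm (f ≫ k) := by
  obtain ⟨h, hh⟩ := hf
  refine ⟨k.hom.toLinearMap ∘ₗ h, fun x => ?_⟩
  have : (f ≫ k).hom x = k.hom (f.hom x) := rfl
  rw [this, hh, map_sum]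
  refine Finset.sum_congr rfl fun g _ => ?_
  exact Rep.hom_comm_apply k g _

lemma IsNorm.precomp {X Y Z : Rep.{0} ℤ G} {f : X ⟶ Y} (hf : IsNorm f) (k : Z ⟶ X) :
    IsNorm (k ≫ f) := by
  obtain ⟨h, hh⟩ := hf
  refine ⟨h ∘ₗ k.hom.toLinearMap, fun x => ?_⟩
  have : (k ≫ f).hom x = f.hom (k.hom x) := rfl
  rw [this, hh]
  refine Finset.sum_congr rfl fun g _ => ?_
  exact congrArg (fun t => Y.ρ g (h t)) (Rep.hom_comm_apply k g⁻¹ x).symm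

lemma IsNorm.whiskerRight {X Y : Rep.{0} ℤ G} {f : X ⟶ Y} (hf : IsNorm f) (W : Rep.{0} ℤ G) :
    IsNorm (f ▷ W) := by
  obtain ⟨h, hh⟩ := hf
  refine ⟨TensorProduct.map h LinearMap.id, fun x => ?_⟩
  have key : (f ▷ W).hom.toLinearMap = ∑ g : G, ((Y ⊗ W).ρ g) ∘ₗ
      (TensorProduct.map h LinearMap.id) ∘ₗ ((X ⊗ W).ρ g⁻¹) := by
    apply TensorProduct.ext'
    intro x w
    have h1 : (f ▷ W).hom.toLinearMap (x ⊗ₜ w) = f.hom x ⊗ₜ w := rfl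
    rw [h1, hh, TensorProduct.sum_tmul, LinearMap.sum_apply]
    refine Finset.sum_congr rfl fun g _ => ?_
    have h2 : ((Y ⊗ W).ρ g ∘ₗ TensorProduct.map h LinearMap.id ∘ₗ (X ⊗ W).ρ g⁻¹) (x ⊗ₜ w)
      = (Y.ρ g (h (X.ρ g⁻¹ x))) ⊗ₜ (W.ρ g (W.ρ g⁻¹ w)) := rfl
    rw [h2, Representation.self_inv_apply]
  have h3 := LinearMap.congr_fun key x
  rw [LinearMap.sum_apply] at h3
  exact h3

/-- Stable equivalence. -/
def StabEq (X Y : Rep.{0} ℤ G) : Prop :=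
  ∃ (f : X ⟶ Y) (g : Y ⟶ X), IsNorm (f ≫ g - 𝟙 X) ∧ IsNorm (g ≫ f - 𝟙 Y)

lemma StabEq.symm {X Y : Rep.{0} ℤ G} (h : StabEq X Y) : StabEq Y X := by
  obtain ⟨f, g, h1, h2⟩ := h
  exact ⟨g, f, h2, h1⟩

lemma StabEq.of_iso {X Y : Rep.{0} ℤ G} (e : X ≅ Y) : StabEq X Y :=
  ⟨e.hom, e.inv, by simpa using IsNorm.zero, by simpa using IsNorm.zero⟩

lemma StabEq.trans {X Y Z : Rep.{0} ℤ G} (h : StabEq X Y) (h' : StabEq Y Z) : StabEq X Z := by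
  obtain ⟨f, g, h1, h2⟩ := h
  obtain ⟨f', g', h1', h2'⟩ := h'
  refine ⟨f ≫ f', g' ≫ g, ?_, ?_⟩
  · have := ((h1'.precomp f).comp g).add h1
    simpa [Preadditive.comp_sub, Preadditive.sub_comp] using this
  · have := ((h2.precomp g').comp f').add h2'
    simpa [Preadditive.comp_sub, Preadditive.sub_comp] using this

lemma StabEq.whiskerRight {X Y : Rep.{0} ℤ G} (h : StabEq X Y) (W : Rep.{0} ℤ G) :
    StabEq (X ⊗ W) (Y ⊗ W) := by
  obtain ⟨f, g, h1, h2⟩ := h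
  refine ⟨f ▷ W, g ▷ W, ?_, ?_⟩
  · have := h1.whiskerRight W
    rw [sub_eq_add_neg] at this ⊢
    convert this using 1
    apply Rep.hom_ext; apply Representation.IntertwiningMap.ext; apply TensorProduct.ext'
    intro x w
    change (g.hom (f.hom x)) ⊗ₜ[ℤ] w + -(x ⊗ₜ[ℤ] w) = (g.hom (f.hom x) + -x) ⊗ₜ[ℤ] w
    rw [TensorProduct.add_tmul, TensorProduct.neg_tmul]
  · have := h2.whiskerRight W
    rw [sub_eq_add_neg] at this ⊢
    convert this using 1
    apply Rep.hom_ext; apply Representation.IntertwiningMap.ext; apply TensorProduct.ext'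
    intro x w
    change (f.hom (g.hom x)) ⊗ₜ[ℤ] w + -(x ⊗ₜ[ℤ] w) = (f.hom (g.hom x) + -x) ⊗ₜ[ℤ] w
    rw [TensorProduct.add_tmul, TensorProduct.neg_tmul]

lemma StabEq.whiskerLeft {X Y : Rep.{0} ℤ G} (h : StabEq X Y) (W : Rep.{0} ℤ G) :
    StabEq (W ⊗ X) (W ⊗ Y) :=
  ((StabEq.of_iso (β_ W X)).trans (h.whiskerRight W)).trans (StabEq.of_iso (β_ Y W))

lemma StabEq.biprod (X : Rep.{0} ℤ G) {P : Rep.{0} ℤ G} (hP : IsNorm (𝟙 P)) :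
    StabEq X (X ⊞ P) := by
  refine ⟨Limits.biprod.inl, Limits.biprod.fst, by simpa using IsNorm.zero, ?_⟩
  have := ((hP.precomp (Limits.biprod.snd : X ⊞ P ⟶ P)).comp (Limits.biprod.inr : P ⟶ X ⊞ P)).neg
  convert this using 1
  rw [← Limits.biprod.total, Category.comp_id]
  abel

/-! ### Yoneda -/

/-- class of a map. -/
noncomputable def cl {i : ℤ} {X A : Rep.{0} ℤ G} (φ : X ⊗ J G i ⟶ A) : tate i (hRep X A) :=
  mkCls (Rep.tensorHomEquiv X (J G i) A φ)

lemma cl_surj {i : ℤ} {X A : Rep.{0} ℤ G} (z : tate i (hRep X A)) :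
    ∃ φ : X ⊗ J G i ⟶ A, cl φ = z := by
  obtain ⟨⟨c, hc⟩, rfl⟩ := Submodule.Quotient.mk_surjective _ z
  let c' : (J G i).V →ₗ[ℤ] (hRep X A).V := c
  let m : J G i ⟶ hRep X A := Rep.ofHom
    { toLinearMap := c'
      isIntertwining' := by
        intro g
        have h := hc g
        have h' : (hRep X A).ρ g ∘ₗ c' ∘ₗ (J G i).ρ g⁻¹ = c' := h
        apply LinearMap.ext
        intro (v : (J G i).V)
        have h2 := LinearMap.congr_fun h' ((J G i).ρ g v)
        change (hRep X A).ρ g (c' ((J G i).ρ g⁻¹ ((J G i).ρ g v))) = _ at h2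
        rw [Representation.inv_self_apply] at h2
        exact h2.symm }
  refine ⟨(Rep.tensorHomEquiv X (J G i) A).symm m, ?_⟩
  unfold cl
  rw [Equiv.apply_symm_apply]
  rfl

lemma cl_add {i : ℤ} {X A : Rep.{0} ℤ G} (φ ψ : X ⊗ J G i ⟶ A) : cl (φ + ψ) = cl φ + cl ψ := rfl

lemma rnorm_hh_apply {Y X A : Rep.{0} ℤ G} (c : Y.V →ₗ[ℤ] (X.V →ₗ[ℤ] A.V)) (y : Y.V) (x : X.V) :
    (show Y.V →ₗ[ℤ] (X.V →ₗ[ℤ] A.V) from rnorm (hRep Y (hRep X A)).ρ c) y x =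
      ∑ g : G, A.ρ g (c (Y.ρ g⁻¹ y) (X.ρ g⁻¹ x)) := by
  have h1 : rnorm (hRep Y (hRep X A)).ρ c = ∑ g : G, (hRep Y (hRep X A)).ρ g c :=
    LinearMap.sum_apply _ _ _
  have key : ∀ F : G → (Y.V →ₗ[ℤ] (X.V →ₗ[ℤ] A.V)), (∑ g, F g) y x = ∑ g, F g y x := by
    intro F
    rw [LinearMap.sum_apply, LinearMap.sum_apply]
  refine (congrArg (fun t : Y.V →ₗ[ℤ] (X.V →ₗ[ℤ] A.V) => t y x) h1).trans ?_
  exact key _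

lemma cl_eq_iff {i : ℤ} {X A : Rep.{0} ℤ G} (φ ψ : X ⊗ J G i ⟶ A) :
    cl φ = cl ψ ↔ IsNorm (φ - ψ) := by
  refine (Submodule.Quotient.eq _).trans ?_
  constructor
  · rintro ⟨c, hc⟩
    have hc' := congrArg Subtype.val hc
    change rnorm (hRep (J G i) (hRep X A)).ρ c = _ at hc'
    let c' : (J G i).V →ₗ[ℤ] (X.V →ₗ[ℤ] A.V) := c
    refine ⟨TensorProduct.lift c'.flip, fun t => ?_⟩
    have key : (φ - ψ).hom.toLinearMap = ∑ g : G, A.ρ g ∘ₗ (TensorProduct.lift c'.flip) ∘ₗ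
        ((X ⊗ J G i).ρ g⁻¹) := by
      apply TensorProduct.ext'
      intro x j
      have h1 := LinearMap.congr_fun (LinearMap.congr_fun hc' j) x
      rw [LinearMap.sum_apply]
      exact Eq.trans h1.symm (rnorm_hh_apply c' j x)
    have h3 := LinearMap.congr_fun key t
    rw [LinearMap.sum_apply] at h3
    exact h3
  · rintro ⟨h, hh⟩
    refine ⟨(TensorProduct.curry h).flip, ?_⟩
    apply Subtype.ext
    let c' : (J G i).V →ₗ[ℤ] (X.V →ₗ[ℤ] A.V) := (TensorProduct.curry h).flip
    have : ∀ d : (J G i).V →ₗ[ℤ] (X.V →ₗ[ℤ] A.V),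
        (∀ j x, (φ - ψ).hom (x ⊗ₜ[ℤ] j) = d j x) →
        d = (TensorProduct.curry (φ - ψ).hom.toLinearMap).flip := by
      intro d hd
      apply LinearMap.ext
      intro j
      apply LinearMap.ext
      intro x
      exact (hd j x).symm
    refine (this (rnorm (hRep (J G i) (hRep X A)).ρ c') ?_)
    intro j x
    exact (hh (x ⊗ₜ j)).trans (rnorm_hh_apply c' j x).symm

lemma tmap_cl {i : ℤ} {X A B : Rep.{0} ℤ G} (φ : X ⊗ J G i ⟶ A) (f : A ⟶ B) :
    tmap i ((Rep.ihom X).map f) (cl φ) = cl (φ ≫ f) := rfl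

lemma stab_of_enc {X X' : Rep.{0} ℤ G} (h : IsEncodingPair 0 X X') :
    ∃ i : ℤ, StabEq (X ⊗ J G i) (X' ⊗ J G i) := by
  obtain ⟨i, e, he⟩ := h
  have hi : i + 0 = i := add_zero i
  generalize i + 0 = j at e he hi
  subst hi
  refine ⟨j, ?_⟩
  obtain ⟨u, hu⟩ := cl_surj (e _ (cl (𝟙 (X ⊗ J G j))))
  obtain ⟨v, hv⟩ := cl_surj ((e _).symm (cl (𝟙 (X' ⊗ J G j))))
  have hv' : e _ (cl v) = cl (𝟙 (X' ⊗ J G j)) := by rw [hv, AddEquiv.apply_symm_apply]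
  refine ⟨v, u, ?_, ?_⟩
  · rw [← cl_eq_iff]
    apply (e _).injective
    rw [← tmap_cl, he, hv', tmap_cl, Category.id_comp, hu]
  · rw [← cl_eq_iff, ← tmap_cl, hu, ← he, tmap_cl, Category.id_comp, hv']

lemma enc_of_stab {X X' : Rep.{0} ℤ G} (h : StabEq X X') : IsEncodingPair 0 X X' := by
  have h2 := h.whiskerRight (J G 0)
  obtain ⟨f, g, hfg, hgf⟩ := h2
  choose r hr using fun (Y A : Rep.{0} ℤ G) (z : tate 0 (hRep Y A)) => cl_surj z
  have key : ∀ (Y Y' A : Rep.{0} ℤ G) (g : Y' ⊗ J G 0 ⟶ Y ⊗ J G 0) (φ : Y ⊗ J G 0 ⟶ A),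
      cl (g ≫ r Y A (cl φ)) = cl (g ≫ φ) := by
    intro Y Y' A g φ
    rw [cl_eq_iff, ← Preadditive.comp_sub]
    exact ((cl_eq_iff _ _).1 (hr _ _ _)).precomp g
  have inv : ∀ (Y Y' A : Rep.{0} ℤ G) (g : Y' ⊗ J G 0 ⟶ Y ⊗ J G 0)
      (f : Y ⊗ J G 0 ⟶ Y' ⊗ J G 0) (_ : IsNorm (f ≫ g - 𝟙 _)) (z : tate 0 (hRep Y A)),
      cl (f ≫ r Y' A (cl (g ≫ r Y A z))) = z := by
    intro Y Y' A g f hn z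
    rw [key]
    conv_rhs => rw [← hr _ _ z]
    rw [cl_eq_iff]
    have := hn.comp (r Y A z)
    simpa [Preadditive.sub_comp] using this
  refine ⟨0, fun A =>
    { toFun := fun z => cl (g ≫ r X A z)
      invFun := fun z => cl (f ≫ r X' A z)
      left_inv := inv _ _ _ _ _ hfg
      right_inv := inv _ _ _ _ _ hgf
      map_add' := fun a b => ?_ }, ?_⟩
  · obtain ⟨a, rfl⟩ := cl_surj a
    obtain ⟨b, rfl⟩ := cl_surj b
    rw [← cl_add, key, key, key, Preadditive.comp_add]
    rfl
  · intro A B φ z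
    obtain ⟨z, rfl⟩ := cl_surj z
    change cl (g ≫ r X B (tmap 0 ((Rep.ihom X).map φ) (cl z))) =
      tmap 0 ((Rep.ihom X').map φ) (cl (g ≫ r X A (cl z)))
    rw [tmap_cl, key, key, tmap_cl, Category.assoc]

end Enc14

open CategoryTheory MonoidalCategory TensorProduct
set_option linter.unusedSectionVars false
set_option maxHeartbeats 1000000
open CategoryTheory MonoidalCategory Enc

namespace Enc14

variable {G : Type} [Group G] [Fintype G]

lemma aug_eq_sum (x : G →₀ ℤ) : aug G x = ∑ g : G, x g := by
  unfold aug
  rw [Finsupp.linearCombination_apply, Finsupp.sum_fintype _ _ (by simp)]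
  simp

lemma sum_coe (x : IGcar G) : ∑ g : G, x.1 g = 0 := by
  rw [← aug_eq_sum]; exact x.2

lemma ig_neg_smul (r : ℤ) (x : IGcar G) : (-r) • x = -(r • x) := by
  apply Subtype.ext
  change (-r) • x.1 = -(r • x.1)
  simp

lemma ig_smul_sub (r : ℤ) (x y : IGcar G) : r • (x - y) = r • x - r • y := by
  apply Subtype.ext
  change r • (x.1 - y.1) = r • x.1 - r • y.1
  exact smul_sub _ _ _

/-- The element `e_b - e_c` of the augmentation ideal. -/
noncomputable def ee (b c : G) : IGcar G :=
  ⟨Finsupp.single b 1 - Finsupp.single c 1, by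
    rw [LinearMap.mem_ker]; simp [aug]⟩

lemma ee_coe (b c d : G) : (ee b c).1 d = (Finsupp.single b (1:ℤ)) d - (Finsupp.single c (1 : ℤ)) d := rfl

lemma ee_trans (b c d : G) : ee b c + ee c d = ee b d := by
  apply Subtype.ext
  change (Finsupp.single b 1 - Finsupp.single c 1) + (Finsupp.single c 1 - Finsupp.single d 1)
    = Finsupp.single b (1:ℤ) - Finsupp.single d 1
  abel

lemma IG_apply (g : G) (x : IGcar G) (b : G) : ((IGρ G g x).1) b = x.1 (g⁻¹ * b) := by
  change Finsupp.mapDomain (g • ·) x.1 b = _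
  have : b = g • (g⁻¹ * b) := by simp
  conv_lhs => rw [this]
  exact Finsupp.mapDomain_apply (MulAction.injective g) _ _

lemma IG_ee (g b c : G) : IGρ G g (ee b c) = ee (g * b) (g * c) := by
  apply Subtype.ext
  change Finsupp.mapDomain (g • ·) (Finsupp.single b (1:ℤ) - Finsupp.single c 1) = _
  rw [sub_eq_add_neg, ← Finsupp.single_neg, Finsupp.mapDomain_add, Finsupp.mapDomain_single, Finsupp.mapDomain_single,
    Finsupp.single_neg, ← sub_eq_add_neg]
  rfl

/-- Any element is a combination of the `ee b c`. -/
lemma IG_expand (x : IGcar G) (c : G) : x = ∑ b : G, x.1 b • ee b c := by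
  apply Subtype.ext
  apply Finsupp.ext
  intro d
  have h : ∀ F : G → IGcar G, (∑ b, F b).1 d = ∑ b, (F b).1 d := by
    intro F
    exact map_sum ((Finsupp.lapply d : (G →₀ ℤ) →ₗ[ℤ] ℤ) ∘ₗ (LinearMap.ker (aug G)).subtype) F _
  rw [h]
  have h2 : ∀ b, (x.1 b • ee b c).1 d = x.1 b * Finsupp.single b (1:ℤ) d - x.1 b * Finsupp.single c (1:ℤ) d := by
    intro b
    change x.1 b • (ee b c).1 d = _
    rw [ee_coe, smul_eq_mul, mul_sub]
  simp only [h2]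
  rw [Finset.sum_sub_distrib, ← Finset.sum_mul, sum_coe]
  classical
  simp [Finsupp.single_apply]

/-- coordinate functional. -/
noncomputable def co (b : G) : IGcar G →ₗ[ℤ] ℤ :=
  (Finsupp.lapply b : (G →₀ ℤ) →ₗ[ℤ] ℤ) ∘ₗ (LinearMap.ker (aug G)).subtype

lemma co_apply (b : G) (x : IGcar G) : co b x = x.1 b := rfl

/-- trace relative to the base point `c`. -/
noncomputable def T (c : G) : (IGcar G →ₗ[ℤ] IGcar G) →ₗ[ℤ] ℤ :=
  ∑ b : G, co b ∘ₗ LinearMap.applyₗ (ee b c)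

lemma T_apply (c : G) (φ : IGcar G →ₗ[ℤ] IGcar G) : T c φ = ∑ b : G, (φ (ee b c)).1 b := by
  unfold T
  rw [LinearMap.sum_apply]
  rfl

lemma T_indep (c d : G) (φ : IGcar G →ₗ[ℤ] IGcar G) : T c φ = T d φ := by
  rw [T_apply, T_apply]
  have : ∀ b, (φ (ee b d)).1 b = (φ (ee b c)).1 b + (φ (ee c d)).1 b := by
    intro b
    rw [← ee_trans b c d, map_add]; rfl
  simp only [this]
  rw [Finset.sum_add_distrib, sum_coe, add_zero]

lemma T_id (c : G) : T c (LinearMap.id) = (Fintype.card G : ℤ) - 1 := by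
  classical
  rw [T_apply]
  simp only [LinearMap.id_apply, ee_coe]
  simp [Finsupp.single_apply]

variable (G) in
/-- endomorphisms of the augmentation ideal -/
noncomputable abbrev EI : Rep.{0} ℤ G := hRep (IGrep G) (IGrep G)

lemma T_conj (g : G) (φ : IGcar G →ₗ[ℤ] IGcar G) :
    T 1 (IGρ G g ∘ₗ φ ∘ₗ IGρ G g⁻¹) = T 1 φ := by
  rw [T_indep 1 g⁻¹ φ, T_apply, T_apply]
  refine Fintype.sum_equiv (Equiv.mulLeft g⁻¹) _ _ fun b => ?_
  change (IGρ G g (φ (IGρ G g⁻¹ (ee b 1)))).1 b = _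
  rw [IG_apply, IG_ee, mul_one]
  rfl

/-- unit map -/
noncomputable def uE : 𝟙_ (Rep ℤ G) ⟶ EI G := Rep.ofHom
  { toLinearMap := LinearMap.toSpanSingleton ℤ (IGcar G →ₗ[ℤ] IGcar G) LinearMap.id
    isIntertwining' := by
      intro g
      apply LinearMap.ext
      intro (z : ℤ)
      change z • LinearMap.id = IGρ G g ∘ₗ (z • LinearMap.id) ∘ₗ IGρ G g⁻¹
      apply LinearMap.ext
      intro x
      change z • x = IGρ G g (z • IGρ G g⁻¹ x)
      rw [map_smul, Representation.self_inv_apply] }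

/-- minus the trace -/
noncomputable def tE : EI G ⟶ 𝟙_ (Rep ℤ G) := Rep.ofHom
  { toLinearMap := -T 1
    isIntertwining' := by
      intro g
      apply LinearMap.ext
      intro (φ : IGcar G →ₗ[ℤ] IGcar G)
      change -T 1 (IGρ G g ∘ₗ φ ∘ₗ IGρ G g⁻¹) = -T 1 φ
      rw [T_conj] }

lemma norm_one : IsNorm (uE ≫ tE - 𝟙 (𝟙_ (Rep ℤ G))) := by
  refine ⟨-LinearMap.id, fun (z : ℤ) => ?_⟩
  change -T (1 : G) (z • LinearMap.id) - z = ∑ g : G, - z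
  rw [map_smul, T_id]
  simp
  ring

/-- homotopy -/
noncomputable def hE : (IGcar G →ₗ[ℤ] IGcar G) →ₗ[ℤ] (IGcar G →ₗ[ℤ] IGcar G) :=
  LinearMap.mk₂ ℤ (fun φ x => ∑ b : G, (-(co b x * co 1 (φ (ee b 1)))) • ee 1 b)
    (fun φ φ' x => by
      simp only [LinearMap.add_apply, map_add, mul_add, neg_add, add_smul, Finset.sum_add_distrib])
    (fun c φ x => by
      rw [Finset.smul_sum]
      refine Finset.sum_congr rfl fun b _ => ?_
      rw [LinearMap.smul_apply, map_smul, smul_smul, smul_eq_mul]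
      congr 1
      ring)
    (fun φ x x' => by
      simp only [map_add, add_mul, neg_add, add_smul, Finset.sum_add_distrib])
    (fun c φ x => by
      rw [Finset.smul_sum]
      refine Finset.sum_congr rfl fun b _ => ?_
      rw [map_smul, smul_smul, smul_eq_mul]
      congr 1
      ring)

lemma hE_apply (φ : IGcar G →ₗ[ℤ] IGcar G) (x : IGcar G) :
    hE φ x = - ∑ b : G, (x.1 b) • ((φ (ee b 1)).1 1 • ee 1 b) := by
  unfold hE
  rw [LinearMap.mk₂_apply, ← Finset.sum_neg_distrib]
  refine Finset.sum_congr rfl fun b _ => ?_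
  rw [ig_neg_smul, smul_smul]
  rfl

lemma norm_E_aux (φ : IGcar G →ₗ[ℤ] IGcar G) (x : IGcar G) :
    (-T 1 φ) • x - φ x = ∑ g : G, IGρ G g (hE (IGρ G g⁻¹ ∘ₗ φ ∘ₗ IGρ G g) (IGρ G g⁻¹ x)) := by
  have h1 : ∀ g, IGρ G g (hE (IGρ G g⁻¹ ∘ₗ φ ∘ₗ IGρ G g) (IGρ G g⁻¹ x)) =
      - ∑ b : G, (x.1 b) • ((φ (ee b g)).1 g • ee g b) := by
    intro g
    rw [hE_apply, map_neg, map_sum]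
    congr 1
    refine Fintype.sum_equiv (Equiv.mulLeft g) _ _ fun b => ?_
    rw [map_smul, map_smul, IG_ee, IG_apply, LinearMap.comp_apply, LinearMap.comp_apply, IG_apply, IG_ee]
    simp
  simp only [h1]
  rw [Finset.sum_neg_distrib, ig_neg_smul, ← neg_add', neg_inj]
  have h2 : ∀ g b : G, (x.1 b) • ((φ (ee b g)).1 g • ee g b) =
      (x.1 b * (φ (ee b g)).1 g) • ee g 1 - (x.1 b * (φ (ee b g)).1 g) • ee b 1 := by
    intro g b
    have hb : ee g b = ee g 1 - ee b 1 := by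
      apply Subtype.ext
      change Finsupp.single g 1 - Finsupp.single b 1 = (Finsupp.single g 1 - Finsupp.single 1 1)
        - (Finsupp.single b 1 - Finsupp.single 1 (1:ℤ))
      abel
    rw [smul_smul, hb, ig_smul_sub]
  simp only [h2, Finset.sum_sub_distrib]
  have h3 : ∀ g, ∑ b : G, (x.1 b * (φ (ee b g)).1 g) • ee g 1 = (φ x).1 g • ee g (1 : G) := by
    intro g
    rw [← Finset.sum_smul]
    congr 1
    conv_rhs => rw [IG_expand x g, map_sum, ← co_apply, map_sum]
    refine Finset.sum_congr rfl fun b _ => ?_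
    rw [map_smul, map_smul]
    rfl
  simp only [h3]
  rw [← IG_expand (φ x) 1, Finset.sum_comm]
  have h4 : ∀ b, ∑ g : G, (x.1 b * (φ (ee b g)).1 g) • ee b (1 : G) = (-T 1 φ) • (x.1 b • ee b (1 : G)) := by
    intro b
    rw [← Finset.sum_smul, ← Finset.mul_sum, smul_smul, T_indep 1 b, T_apply]
    congr 1
    rw [mul_comm, ← Finset.sum_neg_distrib]
    congr 1
    refine Finset.sum_congr rfl fun g _ => ?_
    have : ee b g = - ee g b := by
      apply Subtype.ext
      change Finsupp.single b 1 - Finsupp.single g 1 = -(Finsupp.single g 1 - Finsupp.single b (1:ℤ))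
      abel
    rw [this, map_neg]
    rfl
  simp only [h4]
  rw [← Finset.smul_sum, ← IG_expand x 1, ig_neg_smul, sub_neg_eq_add, add_comm]

lemma norm_E : IsNorm (tE ≫ uE - 𝟙 (EI G)) := by
  refine ⟨hE, fun (φ : IGcar G →ₗ[ℤ] IGcar G) => ?_⟩
  have h : ∀ F : G → (IGcar G →ₗ[ℤ] IGcar G), 
      (∀ x, ((-T 1 φ) • x - φ x = ∑ g, F g x)) → ((-T 1 φ) • LinearMap.id - φ = ∑ g, F g) := by
    intro F hF
    apply LinearMap.ext
    intro x
    rw [LinearMap.sum_apply, ← hF]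
    rfl
  refine h (fun g => (EI G).ρ g (hE ((EI G).ρ g⁻¹ φ))) fun x => ?_
  rw [norm_E_aux]
  refine Finset.sum_congr rfl fun g _ => ?_
  change _ = IGρ G g (hE (IGρ G g⁻¹ ∘ₗ φ ∘ₗ IGρ G (g⁻¹)⁻¹) (IGρ G g⁻¹ x))
  rw [inv_inv]

lemma stab_EI : StabEq (𝟙_ (Rep ℤ G)) (EI G) := ⟨uE, tE, norm_one, norm_E⟩

/-- `D ⊗ I ≅ End I` -/
noncomputable def isoDI : DIG G ⊗ IGrep G ≅ EI G :=
  Rep.mkIso (Representation.Equiv.mk (dualTensorHomEquiv ℤ (IGcar G) (IGcar G)) fun g => by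
    apply LinearMap.ext
    intro t
    exact conj_dualTensor G g t)

lemma stab_DI : StabEq (DIG G ⊗ IGrep G) (𝟙_ (Rep ℤ G)) :=
  (StabEq.of_iso isoDI).trans stab_EI.symm

lemma stab_ID : StabEq (IGrep G ⊗ DIG G) (𝟙_ (Rep ℤ G)) :=
  (StabEq.of_iso (β_ _ _)).trans stab_DI

lemma StabEq.cancel {A B C D : Rep.{0} ℤ G} (hCD : StabEq (C ⊗ D) (𝟙_ (Rep ℤ G)))
    (h : StabEq (A ⊗ C) (B ⊗ C)) : StabEq A B := by
  have key : ∀ Z : Rep.{0} ℤ G, StabEq ((Z ⊗ C) ⊗ D) Z := fun Z =>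
    ((StabEq.of_iso (α_ Z C D)).trans (hCD.whiskerLeft Z)).trans (StabEq.of_iso (ρ_ Z))
  exact ((key A).symm.trans (h.whiskerRight D)).trans (key B)

lemma cancel_Jp {A B : Rep.{0} ℤ G} (n : ℕ) (h : StabEq (A ⊗ Jp G n) (B ⊗ Jp G n)) :
    StabEq A B := by
  induction n with
  | zero => exact ((StabEq.of_iso (ρ_ A).symm).trans h).trans (StabEq.of_iso (ρ_ B))
  | succ n ih =>
    refine ih (StabEq.cancel stab_ID ?_)
    exact ((StabEq.of_iso (α_ A (Jp G n) (IGrep G))).trans h).trans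
      (StabEq.of_iso (α_ B (Jp G n) (IGrep G)).symm)

lemma cancel_Jn {A B : Rep.{0} ℤ G} (n : ℕ) (h : StabEq (A ⊗ Jn G n) (B ⊗ Jn G n)) :
    StabEq A B := by
  induction n with
  | zero => exact ((StabEq.of_iso (ρ_ A).symm).trans h).trans (StabEq.of_iso (ρ_ B))
  | succ n ih =>
    refine ih (StabEq.cancel stab_DI ?_)
    exact ((StabEq.of_iso (α_ A (Jn G n) (DIG G))).trans h).trans
      (StabEq.of_iso (α_ B (Jn G n) (DIG G)).symm)

lemma cancel_J {A B : Rep.{0} ℤ G} (i : ℤ) (h : StabEq (A ⊗ J G i) (B ⊗ J G i)) :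
    StabEq A B := by
  cases i with
  | ofNat n => exact cancel_Jp n h
  | negSucc n => exact cancel_Jn (n + 1) h

end Enc14

open CategoryTheory MonoidalCategory TensorProduct
set_option linter.unusedSectionVars false
set_option maxHeartbeats 1000000
open CategoryTheory MonoidalCategory Enc

namespace Enc14

variable {G : Type} [Group G] [Fintype G]

/-- The projection from the induced module. -/
noncomputable def piInd (X : Rep.{0} ℤ G) : indRep G X.V ⟶ X := Rep.ofHom
  { toLinearMap := (Finsupp.lsum ℤ fun g : G => X.ρ g : (G →₀ X.V) →ₗ[ℤ] X.V)
    isIntertwining' := by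
      intro g
      apply Finsupp.lhom_ext
      intro h v
      change Finsupp.lsum ℤ (fun g : G => X.ρ g) (Finsupp.mapDomain (fun h => g * h) (Finsupp.single h v))
        = X.ρ g (Finsupp.lsum ℤ (fun g : G => X.ρ g) (Finsupp.single h v))
      rw [Finsupp.mapDomain_single]
      simp }

lemma isNorm_ind (X : Rep.{0} ℤ G) : IsNorm (𝟙 (indRep G X.V)) := by
  refine ⟨(Finsupp.lsingle 1 ∘ₗ Finsupp.lapply 1 : (G →₀ X.V) →ₗ[ℤ] (G →₀ X.V)),
    fun (x : G →₀ X.V) => ?_⟩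
  have h : ∀ g, (indRep G X.V).ρ g ((Finsupp.lsingle 1 ∘ₗ Finsupp.lapply 1 : (G →₀ X.V) →ₗ[ℤ] (G →₀ X.V))
      ((indRep G X.V).ρ g⁻¹ x)) = Finsupp.single g (x g) := by
    intro g
    change Finsupp.mapDomain (fun h => g * h) (Finsupp.single 1
      (Finsupp.mapDomain (fun h => g⁻¹ * h) x 1)) = _
    rw [Finsupp.mapDomain_single, mul_one]
    congr 1
    have : (1 : G) = (fun h => g⁻¹ * h) g := by simp
    conv_lhs => rw [this]
    exact Finsupp.mapDomain_apply (mul_right_injective g⁻¹) _ _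
  refine Eq.trans ?_ (Finset.sum_congr rfl fun g _ => (h g).symm)
  exact (Finsupp.univ_sum_single x).symm

lemma IsNorm.lift {Y X : Rep.{0} ℤ G} {f : Y ⟶ X} (hf : IsNorm f) :
    ∃ l : Y ⟶ indRep G X.V, l ≫ piInd X = f := by
  obtain ⟨h, hh⟩ := hf
  let L : Y.V →ₗ[ℤ] (G →₀ X.V) := ∑ g : G, Finsupp.lsingle g ∘ₗ h ∘ₗ Y.ρ g⁻¹
  have hL : ∀ y, L y = ∑ g : G, Finsupp.single g (h (Y.ρ g⁻¹ y)) := by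
    intro y
    change (∑ g : G, Finsupp.lsingle g ∘ₗ h ∘ₗ Y.ρ g⁻¹) y = _
    rw [LinearMap.sum_apply]; rfl
  refine ⟨Rep.ofHom
    { toLinearMap := L
      isIntertwining' := ?_ }, ?_⟩
  · intro g
    apply LinearMap.ext
    intro y
    change L (Y.ρ g y) = Finsupp.lmapDomain X.V ℤ (fun h => g * h) (L y)
    rw [hL, hL, map_sum]
    refine Fintype.sum_equiv (Equiv.mulLeft g⁻¹) _ _ fun b => ?_
    change _ = Finsupp.mapDomain (fun h => g * h) _
    rw [Finsupp.mapDomain_single]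
    simp
  · apply Rep.hom_ext
    apply Representation.IntertwiningMap.ext
    apply LinearMap.ext
    intro y
    refine Eq.trans ?_ (hh y).symm
    change Finsupp.lsum ℤ (fun g : G => X.ρ g) (L y) = _
    rw [hL, map_sum]
    simp

lemma piInd_surj (X : Rep.{0} ℤ G) : Function.Surjective (piInd X).hom := by
  intro x
  refine ⟨(Finsupp.single 1 x : G →₀ X.V), ?_⟩
  change Finsupp.lsum ℤ (fun g : G => X.ρ g) (Finsupp.single 1 x) = x
  simp

lemma isNorm_of_projective (P : Rep.{0} ℤ G)
    (hP : Module.Projective (MonoidAlgebra ℤ G) P.ρ.asModule) : IsNorm (𝟙 P) := by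
  obtain ⟨s, hs⟩ := Module.projective_lifting_property
    (Representation.IntertwiningMap.equivLinearMapAsModule _ _ (piInd P).hom)
    (LinearMap.id : P.ρ.asModule →ₗ[MonoidAlgebra ℤ G] P.ρ.asModule) (piInd_surj P)
  let l : P ⟶ indRep G P.V :=
    Rep.ofHom ((Representation.IntertwiningMap.equivLinearMapAsModule _ _).symm s)
  have hl : l ≫ 𝟙 _ ≫ piInd P = 𝟙 P := by
    rw [Category.id_comp]
    apply Rep.hom_ext
    apply Representation.IntertwiningMap.ext
    apply LinearMap.ext
    intro x
    exact LinearMap.congr_fun hs x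
  rw [← hl]
  exact ((isNorm_ind P).comp _).precomp _

/-- averaging a linear map -/
noncomputable def avg {X Y : Rep.{0} ℤ G} (h : X.V →ₗ[ℤ] Y.V) : X ⟶ Y := Rep.ofHom
  { toLinearMap := ∑ g : G, Y.ρ g ∘ₗ h ∘ₗ X.ρ g⁻¹
    isIntertwining' := by
      intro g
      apply LinearMap.ext
      intro x
      rw [LinearMap.comp_apply, LinearMap.comp_apply, LinearMap.sum_apply, LinearMap.sum_apply, map_sum]
      refine Fintype.sum_equiv (Equiv.mulLeft g⁻¹) _ _ fun b => ?_
      simp }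

lemma avg_apply {X Y : Rep.{0} ℤ G} (h : X.V →ₗ[ℤ] Y.V) (x : X.V) :
    (avg h).hom x = ∑ g : G, Y.ρ g (h (X.ρ g⁻¹ x)) :=
  LinearMap.sum_apply _ _ _

lemma exists_section {F P : Rep.{0} ℤ G} (hf : Module.Projective ℤ P.V) (hP : IsNorm (𝟙 P))
    (p : F ⟶ P) (hp : Function.Surjective p.hom) : ∃ s : P ⟶ F, s ≫ p = 𝟙 P := by
  obtain ⟨h, hh⟩ := hP
  obtain ⟨t, ht⟩ := LinearMap.exists_rightInverse_of_surjective p.hom.toLinearMap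
    (LinearMap.range_eq_top.2 hp)
  refine ⟨avg (t ∘ₗ h), ?_⟩
  apply Rep.hom_ext
  apply Representation.IntertwiningMap.ext
  apply LinearMap.ext
  intro x
  refine Eq.trans ?_ (hh x).symm
  change p.hom ((avg (t ∘ₗ h)).hom x) = _
  rw [avg_apply, map_sum]
  refine Finset.sum_congr rfl fun g _ => ?_
  rw [Rep.hom_comm_apply]
  exact congrArg (P.ρ g) (LinearMap.congr_fun ht _)

lemma projective_of_isNorm (P : Rep.{0} ℤ G) (hf : Module.Projective ℤ P.V) (hP : IsNorm (𝟙 P)) :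
    Module.Projective (MonoidAlgebra ℤ G) P.ρ.asModule := by
  obtain ⟨s, hs⟩ := exists_section hf hP (Rep.freeLift ℤ G P (id : P.V → P.V)) (by
    intro x
    refine ⟨Finsupp.single x (MonoidAlgebra.single 1 1), ?_⟩
    simp)
  haveI := Representation.free_asModule_free (k := ℤ) (G := G) P.V
  refine Module.Projective.of_split (M := (Representation.free ℤ G P.V).asModule)
    (Representation.IntertwiningMap.equivLinearMapAsModule _ _ s.hom)
    (Representation.IntertwiningMap.equivLinearMapAsModule _ _ (Rep.freeLift ℤ G P (id : P.V → P.V)).hom) ?_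
  apply LinearMap.ext
  intro x
  exact congrArg (fun t : P ⟶ P => t.hom x) hs

open Limits in
lemma exists_proj {X X' : Rep.{0} ℤ G} (h1 : Module.Free ℤ X.V) (h2 : Module.Free ℤ X'.V)
    (h : StabEq X X') : ∃ P P' : Rep.{0} ℤ G,
      Module.Projective (MonoidAlgebra ℤ G) P.ρ.asModule ∧
        Module.Projective (MonoidAlgebra ℤ G) P'.ρ.asModule ∧
        Nonempty (X ⊞ P ≅ X' ⊞ P') := by
  obtain ⟨f, g, hfg, hgf⟩ := h
  obtain ⟨l, hl⟩ := hgf.lift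
  have hF := isNorm_ind X'
  have hFfree : Module.Free ℤ (indRep G X'.V).V := inferInstanceAs (Module.Free ℤ (G →₀ X'.V))
  generalize piInd X' = π at *
  generalize indRep G X'.V = F at *
  let p : X ⊞ F ⟶ X' := biprod.desc f π
  let s : X' ⟶ X ⊞ F := g ≫ biprod.inl - l ≫ biprod.inr
  have hsp : s ≫ p = 𝟙 X' := by
    simp [s, p, Preadditive.sub_comp, hl]
  have hps : IsNorm (𝟙 _ - p ≫ s) := by
    have e1 := ((hfg.precomp (biprod.fst : X ⊞ F ⟶ X)).comp (biprod.inl : X ⟶ X ⊞ F)).neg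
    have e2 := ((hF.precomp (biprod.snd : X ⊞ F ⟶ F)).comp (biprod.inr - π ≫ s))
    have e3 := ((hF.precomp ((biprod.fst : X ⊞ F ⟶ X) ≫ f ≫ l)).comp (biprod.inr : F ⟶ X ⊞ F))
    have := (e1.add e2).add e3
    convert this using 1
    apply biprod.hom_ext'
    · simp [s, p, Preadditive.comp_sub, Preadditive.sub_comp]
      abel
    · simp [s, p, Preadditive.comp_sub, Preadditive.sub_comp]
  let q : X ⊞ F ⟶ kernel p := kernel.lift p (𝟙 _ - p ≫ s) (by
    rw [Preadditive.sub_comp, Category.assoc, hsp]; simp)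
  have hq : q ≫ kernel.ι p = 𝟙 _ - p ≫ s := kernel.lift_ι _ _ _
  have hιq : kernel.ι p ≫ q = 𝟙 _ := by
    rw [← cancel_mono (kernel.ι p), Category.assoc, hq]
    simp [Preadditive.comp_sub]
  have hsq : s ≫ q = 0 := by
    rw [← cancel_mono (kernel.ι p), Category.assoc, hq, Preadditive.comp_sub, ← Category.assoc, hsp]
    simp
  have hK : IsNorm (𝟙 (kernel p)) := by
    have := (hps.precomp (kernel.ι p)).comp q
    rw [← hq, ← Category.assoc, hιq, Category.id_comp, hιq] at this
    exact this
  have hKfree : Module.Projective ℤ (kernel p).V := by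
    have hprod : Module.Free ℤ (X.V × F.V) := Module.Free.prod ℤ X.V F.V
    refine Module.Projective.of_split (M := X.V × F.V)
      ((kernel.ι p ≫ biprod.fst).hom.toLinearMap.prod (kernel.ι p ≫ biprod.snd).hom.toLinearMap)
      ((biprod.inl ≫ q).hom.toLinearMap.coprod (biprod.inr ≫ q).hom.toLinearMap) ?_
    have h3 : (kernel.ι p ≫ biprod.fst) ≫ biprod.inl ≫ q +
          (kernel.ι p ≫ biprod.snd) ≫ biprod.inr ≫ q = 𝟙 _ := by
      rw [← hιq, ← Category.assoc, ← Category.assoc (kernel.ι p ≫ biprod.snd),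
        ← Preadditive.add_comp, Category.assoc, Category.assoc, ← Preadditive.comp_add,
        biprod.total, Category.comp_id]
    apply LinearMap.ext
    intro x
    exact congrArg (fun t : kernel p ⟶ kernel p => t.hom x) h3
  refine ⟨F, kernel p, projective_of_isNorm F (Module.Projective.of_free) hF, projective_of_isNorm _ hKfree hK, ⟨?_⟩⟩
  refine ⟨biprod.lift p q, biprod.desc s (kernel.ι p), ?_, ?_⟩
  · rw [biprod.lift_desc, hq]; abel
  · apply biprod.hom_ext'
    · apply biprod.hom_ext
      · simp [hsp]
      · simp [hsq]
    · apply biprod.hom_ext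
      · simp
      · simp [hιq]

end Enc14

open CategoryTheory MonoidalCategory Enc

theorem statement14 (G : Type) [Group G] [Fintype G] (X X' : Rep ℤ G)
    (h1 : Module.Free ℤ X.V) (h2 : Module.Free ℤ X'.V) :
    IsEncodingPair 0 X X' ↔
      ∃ P P' : Rep ℤ G, Module.Projective (MonoidAlgebra ℤ G) P.ρ.asModule ∧
        Module.Projective (MonoidAlgebra ℤ G) P'.ρ.asModule ∧
        Nonempty (X ⊞ P ≅ X' ⊞ P') := by
  constructor
  · intro h
    obtain ⟨i, hi⟩ := Enc14.stab_of_enc h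
    exact Enc14.exists_proj h1 h2 (Enc14.cancel_J i hi)
  · rintro ⟨P, P', hP, hP', ⟨e⟩⟩
    apply Enc14.enc_of_stab
    exact ((Enc14.StabEq.biprod X (Enc14.isNorm_of_projective P hP)).trans
      (Enc14.StabEq.of_iso e)).trans
      (Enc14.StabEq.biprod X' (Enc14.isNorm_of_projective P' hP')).symm
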